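/- arXiv:1902.00864 — 13 statements merged into one kernel-verified Lean document; each statement's English description precedes it below -/
import Mathlib

section
/- Every nonempty upper set U of a finite partially ordered set P can be written as a disjoint union of irreducible upper sets, and this decomposition is unique: the collection of irreducible upper sets appearing in such a disjoint decomposition is uniquely determined by U. -/
/-- An irreducible upper set: a nonempty upper set that is not the union of two
disjoint nonempty upper sets. -/
def IrredUpper {P : Type*} [PartialOrder P] (I : Set P) : Prop :=
  IsUpperSet I ∧ I.Nonempty ∧
    ∀ A B : Set P, IsUpperSet A → IsUpperSet B → A.Nonempty → B.Nonempty →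
      Disjoint A B → I ≠ A ∪ B

lemma IrredUpper.subset_of_decomp {P : Type*} [PartialOrder P] {𝓙 : Set (Set P)}
    (hJ : ∀ J ∈ 𝓙, IrredUpper J) (hd : 𝓙.PairwiseDisjoint id) {I J : Set P}
    (hI : IrredUpper I) (hIU : I ⊆ ⋃₀ 𝓙) (hJm : J ∈ 𝓙) (hIJ : (I ∩ J).Nonempty) : I ⊆ J := by
  by_contra hns
  obtain ⟨y, hyI, hyJ⟩ := Set.not_subset.1 hns
  have key : I = (I ∩ J) ∪ (I ∩ ⋃₀ (𝓙 \ {J})) := by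
    ext z
    constructor
    · intro hz
      obtain ⟨K, hK, hzK⟩ := hIU hz
      by_cases h : K = J
      · subst h
        exact Or.inl ⟨hz, hzK⟩
      · exact Or.inr ⟨hz, K, ⟨hK, h⟩, hzK⟩
    · rintro (h | h)
      · exact h.1
      · exact h.1
  refine hI.2.2 _ _ (hI.1.inter (hJ J hJm).1)
    (hI.1.inter (isUpperSet_sUnion fun K hK => (hJ K hK.1).1)) hIJ ?_ ?_ key
  · obtain ⟨K, hK, hyK⟩ := hIU hyI
    refine ⟨y, hyI, K, ⟨hK, ?_⟩, hyK⟩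
    rintro rfl
    exact hyJ hyK
  · rw [Set.disjoint_left]
    rintro z ⟨_, hzJ⟩ ⟨_, K, ⟨hK, hKJ⟩, hzK⟩
    exact Set.disjoint_left.1 (hd hK hJm hKJ) hzK hzJ

lemma decomp_subset {P : Type*} [PartialOrder P] {𝓘 𝓙 : Set (Set P)}
    (hI : ∀ I ∈ 𝓘, IrredUpper I) (hdI : 𝓘.PairwiseDisjoint id)
    (hJ : ∀ J ∈ 𝓙, IrredUpper J) (hdJ : 𝓙.PairwiseDisjoint id)
    (h : ⋃₀ 𝓘 = ⋃₀ 𝓙) : 𝓘 ⊆ 𝓙 := by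
  intro I hIm
  obtain ⟨x, hx⟩ := (hI I hIm).2.1
  have hIU : I ⊆ ⋃₀ 𝓙 := h ▸ Set.subset_sUnion_of_mem hIm
  obtain ⟨J, hJm, hxJ⟩ := hIU hx
  have hJU : J ⊆ ⋃₀ 𝓘 := h ▸ Set.subset_sUnion_of_mem hJm
  have e : I = J := Set.Subset.antisymm
    ((hI I hIm).subset_of_decomp hJ hdJ hIU hJm ⟨x, hx, hxJ⟩)
    ((hJ J hJm).subset_of_decomp hI hdI hJU hIm ⟨x, hxJ, hx⟩)
  exact e ▸ hJm

lemma exists_decomp {P : Type*} [Fintype P] [PartialOrder P] (n : ℕ) :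
    ∀ U : Set P, U.ncard = n → IsUpperSet U → U.Nonempty →
    ∃ 𝓘 : Set (Set P), (∀ I ∈ 𝓘, IrredUpper I) ∧ 𝓘.PairwiseDisjoint id ∧ ⋃₀ 𝓘 = U := by
  induction n using Nat.strong_induction_on with
  | _ n ih =>
    intro U hn hU hne
    by_cases hirr : IrredUpper U
    · exact ⟨{U}, by simpa using hirr, Set.pairwiseDisjoint_singleton _ _, by simp⟩
    · have : ∃ A B : Set P, IsUpperSet A ∧ IsUpperSet B ∧ A.Nonempty ∧ B.Nonempty ∧
          Disjoint A B ∧ U = A ∪ B := by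
        by_contra hcon
        exact hirr ⟨hU, hne, fun A B hA hB hAn hBn hd he => hcon ⟨A, B, hA, hB, hAn, hBn, hd, he⟩⟩
      obtain ⟨A, B, hA, hB, hAn, hBn, hd, rfl⟩ := this
      have hc := Set.ncard_union_eq hd (Set.toFinite A) (Set.toFinite B)
      have hA0 := (Set.ncard_pos (Set.toFinite A)).2 hAn
      have hB0 := (Set.ncard_pos (Set.toFinite B)).2 hBn
      obtain ⟨𝓐, h1, h2, h3⟩ := ih A.ncard (by omega) A rfl hA hAn
      obtain ⟨𝓑, k1, k2, k3⟩ := ih B.ncard (by omega) B rfl hB hBn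
      refine ⟨𝓐 ∪ 𝓑, ?_, ?_, ?_⟩
      · rintro I (h | h)
        · exact h1 I h
        · exact k1 I h
      · refine Set.pairwiseDisjoint_union.2 ⟨h2, k2, fun I hI J hJ _ => ?_⟩
        exact hd.mono (h3 ▸ Set.subset_sUnion_of_mem hI) (k3 ▸ Set.subset_sUnion_of_mem hJ)
      · rw [Set.sUnion_union, h3, k3]

theorem stmt0 {P : Type*} [Fintype P] [PartialOrder P]
    (U : Set P) (hU : IsUpperSet U) (hne : U.Nonempty) :
    ∃! 𝓘 : Set (Set P), (∀ I ∈ 𝓘, IrredUpper I) ∧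
      𝓘.PairwiseDisjoint id ∧ ⋃₀ 𝓘 = U := by
  obtain ⟨𝓘, h1, h2, h3⟩ := exists_decomp _ U rfl hU hne
  refine ⟨𝓘, ⟨h1, h2, h3⟩, ?_⟩
  rintro 𝓙 ⟨k1, k2, k3⟩
  exact Set.Subset.antisymm (decomp_subset k1 k2 h1 h2 (k3.trans h3.symm))
    (decomp_subset h1 h2 k1 k2 (h3.trans k3.symm))
end

section
/- Every monotone function f : P → ℕ on a finite partially ordered set P is a finite sum of indicator functions χ_I of irreducible upper sets I of P (the zero function being the empty sum). In other words, the monoid M(P) is generated by the set {χ_I : I an irreducible upper set of P}. -/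
theorem upper_indicator_sum {P : Type*} [Fintype P] [PartialOrder P] (n : ℕ) :
    ∀ U : Set P, U.ncard = n → IsUpperSet U →
    ∃ L : Multiset (Set P), (∀ I ∈ L, IrredUpper I) ∧
      Set.indicator U (1 : P → ℕ) = (L.map (fun I => Set.indicator I (1 : P → ℕ))).sum := by
  induction n using Nat.strong_induction_on with
  | _ n ih =>
    intro U hn hU
    by_cases hI : IrredUpper U
    · exact ⟨{U}, by simpa using hI, by simp⟩
    rcases U.eq_empty_or_nonempty with rfl | hne
    · exact ⟨0, by simp, by funext x; simp⟩
    unfold IrredUpper at hI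
    push Not at hI
    obtain ⟨A, B, hA, hB, hAn, hBn, hd, rfl⟩ := hI hU hne
    have hc := Set.ncard_union_eq hd (Set.toFinite A) (Set.toFinite B)
    have hA0 : 0 < A.ncard := (Set.ncard_pos (Set.toFinite A)).2 hAn
    have hB0 : 0 < B.ncard := (Set.ncard_pos (Set.toFinite B)).2 hBn
    obtain ⟨L, hL, hLs⟩ := ih A.ncard (by omega) A rfl hA
    obtain ⟨M, hM, hMs⟩ := ih B.ncard (by omega) B rfl hB
    refine ⟨L + M, ?_, ?_⟩
    · intro I h
      rcases Multiset.mem_add.1 h with h | h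
      exacts [hL I h, hM I h]
    · rw [Multiset.map_add, Multiset.sum_add, ← hLs, ← hMs, Set.indicator_union_of_disjoint hd]
      rfl

theorem monotone_sum_aux {P : Type*} [Fintype P] [PartialOrder P] (n : ℕ) :
    ∀ f : P → ℕ, Monotone f → (∀ x, f x ≤ n) →
    ∃ L : Multiset (Set P), (∀ I ∈ L, IrredUpper I) ∧
      f = (L.map (fun I => Set.indicator I (1 : P → ℕ))).sum := by
  induction n with
  | zero =>
    intro f _ h
    exact ⟨0, by simp, by funext x; simpa using h x⟩
  | succ n ih =>
    intro f hf h
    obtain ⟨L, hL, hLs⟩ := ih (fun x => f x - 1)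
      (fun a b hab => Nat.sub_le_sub_right (hf hab) 1) (fun x => by have := h x; omega)
    obtain ⟨M, hM, hMs⟩ := upper_indicator_sum _ {x | 0 < f x} rfl
      (fun a b hab ha => lt_of_lt_of_le ha (hf hab))
    refine ⟨L + M, ?_, ?_⟩
    · intro I h
      rcases Multiset.mem_add.1 h with h | h
      exacts [hL I h, hM I h]
    · rw [Multiset.map_add, Multiset.sum_add, ← hLs, ← hMs]
      funext x
      by_cases hx : 0 < f x
      · simp [Set.indicator, hx]; omega
      · simp [Set.indicator, hx]; omega

theorem stmt1 {P : Type*} [Fintype P] [PartialOrder P]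
    (f : P → ℕ) (hf : Monotone f) :
    ∃ L : Multiset (Set P), (∀ I ∈ L, IrredUpper I) ∧
      f = (L.map (fun I => Set.indicator I (1 : P → ℕ))).sum := by
  exact monotone_sum_aux (∑ x, f x) f hf
    (fun x => Finset.single_le_sum (fun _ _ => Nat.zero_le _) (Finset.mem_univ x))
end

section
/- An element f of the monoid M(P) of monotone ℕ-valued functions on a finite poset P is irreducible — that is, f ≠ 0 and f cannot be written as the sum of two nonzero monotone functions — if and only if f = χ_I for some irreducible upper set I of P. Consequently {χ_I : I an irreducible upper set} is the unique minimal generating set of M(P). -/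
/-- The monoid `M(P)` of monotone functions `P → ℕ`, as an additive submonoid of `P → ℕ`. -/
def monoSubmonoid (P : Type*) [PartialOrder P] : AddSubmonoid (P → ℕ) where
  carrier := {f | Monotone f}
  add_mem' := fun hf hg => hf.add hg
  zero_mem' := monotone_const

/-- The atoms of the monoid of monotone functions. -/
def IsAtomFun {P : Type*} [PartialOrder P] (f : P → ℕ) : Prop :=
  f ≠ 0 ∧ ∀ g h : P → ℕ, Monotone g → Monotone h → g ≠ 0 → h ≠ 0 → f ≠ g + h

theorem upper_support {P : Type*} [PartialOrder P] {f : P → ℕ} (hf : Monotone f) :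
    IsUpperSet {x | f x ≠ 0} := by
  intro a b hab ha
  have := hf hab
  simp only [Set.mem_setOf_eq] at *
  omega

theorem mono_indicator {P : Type*} [PartialOrder P] {I : Set P} (hI : IsUpperSet I) :
    Monotone (Set.indicator I (1 : P → ℕ)) := by
  classical
  intro a b hab
  by_cases ha : a ∈ I
  · have hb := hI hab ha
    simp [ha, hb]
  · simp [ha]

theorem indicator_ne_zero' {P : Type*} {I : Set P} (hI : I.Nonempty) :
    Set.indicator I (1 : P → ℕ) ≠ 0 := by
  obtain ⟨x, hx⟩ := hI
  intro h
  have := congrFun h x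
  simp [hx] at this

theorem support_nonempty' {P : Type*} {f : P → ℕ} (hf : f ≠ 0) :
    {x | f x ≠ 0}.Nonempty := by
  obtain ⟨x, hx⟩ := Function.ne_iff.mp hf
  exact ⟨x, hx⟩

theorem atom_iff {P : Type*} [PartialOrder P] (f : P → ℕ) (hf : Monotone f) :
    IsAtomFun f ↔ ∃ I : Set P, IrredUpper I ∧ f = Set.indicator I 1 := by
  classical
  constructor
  · rintro ⟨h0, hirr⟩
    have hI := upper_support hf
    have hne := support_nonempty' h0
    have hfe : f = Set.indicator {x | f x ≠ 0} 1 := by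
      by_contra hcon
      refine hirr (Set.indicator {x | f x ≠ 0} 1) (fun x => f x - 1) (mono_indicator hI)
        (fun a b hab => Nat.sub_le_sub_right (hf hab) 1) (indicator_ne_zero' hne) ?_ ?_
      · intro hz
        apply hcon
        funext x
        have := congrFun hz x
        simp only [Pi.zero_apply] at this
        simp only [Set.indicator_apply, Set.mem_setOf_eq, Pi.one_apply]
        split_ifs <;> omega
      · funext x
        simp only [Pi.add_apply, Set.indicator_apply, Set.mem_setOf_eq, Pi.one_apply]
        split_ifs <;> omega
    refine ⟨_, ⟨hI, hne, ?_⟩, hfe⟩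
    intro A B hA hB hAn hBn hd hAB
    rw [hAB] at hfe
    refine hirr _ _ (mono_indicator hA) (mono_indicator hB) (indicator_ne_zero' hAn)
      (indicator_ne_zero' hBn) ?_
    rw [hfe, Set.indicator_union_of_disjoint hd]
    rfl
  · rintro ⟨I, ⟨hI, hne, hirr⟩, rfl⟩
    refine ⟨indicator_ne_zero' hne, ?_⟩
    intro g h hg hh hg0 hh0 hgh
    have key : ∀ x, (if x ∈ I then 1 else 0) = g x + h x := by
      intro x
      have := congrFun hgh x
      simpa [Set.indicator_apply] using this
    refine hirr _ _ (upper_support hg) (upper_support hh) (support_nonempty' hg0)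
      (support_nonempty' hh0) ?_ ?_
    · rw [Set.disjoint_left]
      intro x hx hx'
      have := key x
      simp only [Set.mem_setOf_eq] at hx hx'
      split_ifs at this <;> omega
    · ext x
      have := key x
      simp only [Set.mem_union, Set.mem_setOf_eq]
      split_ifs at this with hx
      · simp only [hx, true_iff]; omega
      · simp only [hx, false_iff]; omega

theorem sum_pos_of_ne {P : Type*} [Fintype P] {f : P → ℕ} (hf : f ≠ 0) : 0 < ∑ x, f x := by
  rw [Nat.pos_iff_ne_zero]
  intro h
  apply hf
  funext x
  exact (Finset.sum_eq_zero_iff.mp h) x (Finset.mem_univ x)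

theorem mem_closure_of_mono {P : Type*} [Fintype P] [PartialOrder P] (n : ℕ) :
    ∀ f : P → ℕ, Monotone f → ∑ x, f x = n →
    f ∈ AddSubmonoid.closure {f : P → ℕ | ∃ I : Set P, IrredUpper I ∧ f = Set.indicator I 1} := by
  induction n using Nat.strong_induction_on with
  | _ n ih =>
    intro f hf hn
    by_cases h0 : f = 0
    · rw [h0]; exact zero_mem _
    by_cases hirr : IsAtomFun f
    · exact AddSubmonoid.subset_closure ((atom_iff f hf).mp hirr)
    · unfold IsAtomFun at hirr
      push Not at hirr
      obtain ⟨g, h, hg, hh, hg0, hh0, rfl⟩ := hirr h0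
      have h1 := sum_pos_of_ne hg0
      have h2 := sum_pos_of_ne hh0
      simp only [Pi.add_apply, Finset.sum_add_distrib] at hn
      exact add_mem (ih _ (by omega) g hg rfl) (ih _ (by omega) h hh rfl)

theorem stmt2 {P : Type*} [Fintype P] [PartialOrder P] :
    (∀ f : P → ℕ, Monotone f →
      ((f ≠ 0 ∧ ∀ g h : P → ℕ, Monotone g → Monotone h → g ≠ 0 → h ≠ 0 → f ≠ g + h) ↔
        ∃ I : Set P, IrredUpper I ∧ f = Set.indicator I 1)) ∧
    AddSubmonoid.closure {f : P → ℕ | ∃ I : Set P, IrredUpper I ∧ f = Set.indicator I 1} =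
      monoSubmonoid P ∧
    ∀ S : Set (P → ℕ), (∀ f ∈ S, Monotone f) →
      AddSubmonoid.closure S = monoSubmonoid P →
      {f : P → ℕ | ∃ I : Set P, IrredUpper I ∧ f = Set.indicator I 1} ⊆ S := by
  refine ⟨fun f hf => atom_iff f hf, ?_, ?_⟩
  · apply le_antisymm
    · rw [AddSubmonoid.closure_le]
      rintro f ⟨I, hI, rfl⟩
      exact mono_indicator hI.1
    · intro f hf
      exact mem_closure_of_mono _ f hf rfl
  · rintro S - hcl f ⟨I, hI, hfI⟩
    have hf : Monotone f := hfI ▸ mono_indicator hI.1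
    have hatom : IsAtomFun f := (atom_iff f hf).mpr ⟨I, hI, hfI⟩
    have hmem : f ∈ AddSubmonoid.closure S := by rw [hcl]; exact hf
    clear hfI hf
    induction hmem using AddSubmonoid.closure_induction with
    | mem x hx => exact hx
    | zero => exact absurd rfl hatom.1
    | add x y hx hy ihx ihy =>
      by_cases hx0 : x = 0
      · subst hx0
        rw [zero_add] at hatom ⊢
        exact ihy hatom
      by_cases hy0 : y = 0
      · subst hy0
        rw [add_zero] at hatom ⊢
        exact ihx hatom
      rw [hcl] at hx hy
      exact absurd rfl (hatom.2 x y hx hy hx0 hy0)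
end

section
/- For every monotone function f : P → ℕ on a finite poset P there exist a unique near-chain 𝓘 of irreducible upper sets of P and uniquely determined positive integers a_I for I ∈ 𝓘 such that f = Σ_{I ∈ 𝓘} a_I · χ_I. -/
open Classical in
/-- `a` is a decomposition of `f` along a near-chain. -/
def NCDecomp {P : Type*} [Fintype P] [PartialOrder P] (f : P → ℕ) (a : Set P → ℕ) : Prop :=
  (∀ I : Set P, a I ≠ 0 → IrredUpper I) ∧
  (∀ I J : Set P, a I ≠ 0 → a J ≠ 0 → I ⊆ J ∨ J ⊆ I ∨ I ∩ J = ∅) ∧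
  ∀ x, f x = ∑ I : Set P, if x ∈ I then a I else 0

theorem ncDecomp_iff {P : Type*} [Fintype P] [PartialOrder P] (f : P → ℕ) (a : Set P → ℕ) :
    NCDecomp f a ↔ ((∀ I : Set P, a I ≠ 0 → IrredUpper I) ∧
      (∀ I J : Set P, a I ≠ 0 → a J ≠ 0 → I ⊆ J ∨ J ⊆ I ∨ I ∩ J = ∅) ∧
      f = ∑ᶠ I : Set P, a I • Set.indicator I (1 : P → ℕ)) := by
  classical
  unfold NCDecomp
  rw [finsum_eq_sum_of_fintype, funext_iff]
  simp only [Finset.sum_apply, Pi.smul_apply, Set.indicator_apply, Pi.one_apply, smul_eq_mul,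
    mul_ite, mul_one, mul_zero]

/-- Elements of the support lie in the support of `f`. -/
theorem NCDecomp.pos {P : Type*} [Fintype P] [PartialOrder P] {f : P → ℕ} {a : Set P → ℕ}
    (h : NCDecomp f a) {I : Set P} (hI : a I ≠ 0) {x : P} (hx : x ∈ I) : f x ≠ 0 := by
  classical
  rw [h.2.2 x]
  intro h0
  rw [Finset.sum_eq_zero_iff] at h0
  have := h0 I (Finset.mem_univ _)
  simp [hx] at this
  exact hI this

theorem NCDecomp.exists_mem {P : Type*} [Fintype P] [PartialOrder P] {f : P → ℕ} {a : Set P → ℕ}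
    (h : NCDecomp f a) {x : P} (hx : f x ≠ 0) : ∃ I, a I ≠ 0 ∧ x ∈ I := by
  classical
  rw [h.2.2 x] at hx
  obtain ⟨I, -, hI⟩ := Finset.exists_ne_zero_of_sum_ne_zero hx
  by_cases hxI : x ∈ I
  · exact ⟨I, by simpa [hxI] using hI, hxI⟩
  · simp [hxI] at hI

/-- A nonempty upper set has an irreducible component. -/
theorem exists_component {P : Type*} [Fintype P] [PartialOrder P] (U : Set P)
    (hU : IsUpperSet U) (hne : U.Nonempty) :
    ∃ C ⊆ U, IrredUpper C ∧ IsUpperSet (U \ C) := by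
  classical
  obtain ⟨C, hC⟩ := (Set.toFinite {C : Set P | C ⊆ U ∧ C.Nonempty ∧ IsUpperSet C ∧
    IsUpperSet (U \ C)}).exists_minimal ⟨U, subset_rfl, hne, hU, by simp [isUpperSet_empty]⟩
  obtain ⟨⟨h1, h2, h3, h4⟩, hmin⟩ := hC
  refine ⟨C, h1, ⟨h3, h2, ?_⟩, h4⟩
  intro A B hA hB hAn hBn hd hCe
  have hUA : U \ A = (U \ C) ∪ B := by
    ext x
    have hd' : x ∈ A → x ∉ B := fun hx => Set.disjoint_left.1 hd hx
    have := @h1 x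
    simp only [hCe, Set.mem_union, Set.mem_sdiff] at *
    tauto
  have := hmin (y := A) ⟨fun x hx => h1 (hCe ▸ Or.inl hx), hAn, hA, hUA ▸ h4.union hB⟩
    (fun x hx => hCe ▸ Or.inl hx)
  obtain ⟨x, hx⟩ := hBn
  exact Set.disjoint_left.1 hd (this (hCe ▸ Or.inr hx : x ∈ C)) hx

theorem irred_sub_or {P : Type*} [PartialOrder P] {U C I : Set P} (hC : IsUpperSet C)
    (hUC : IsUpperSet (U \ C)) (hI : IrredUpper I) (hIU : I ⊆ U) : I ⊆ C ∨ I ∩ C = ∅ := by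
  by_contra! h
  obtain ⟨h1, h2⟩ := h
  obtain ⟨x, hx, hxC⟩ := Set.not_subset.1 h1
  refine hI.2.2 (I ∩ C) (I ∩ (U \ C)) (hI.1.inter hC) (hI.1.inter hUC)
    h2 ⟨x, hx, hIU hx, hxC⟩ ?_ ?_
  · rw [Set.disjoint_left]
    rintro y ⟨_, hy⟩ ⟨_, _, hy'⟩
    exact hy' hy
  · ext y
    have := @hIU y
    simp only [Set.mem_union, Set.mem_inter_iff, Set.mem_sdiff]
    tauto

/-- Every decomposition contains each component of the support. -/
theorem NCDecomp.comp_ne {P : Type*} [Fintype P] [PartialOrder P] {f : P → ℕ} {b : Set P → ℕ}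
    (h : NCDecomp f b) {C : Set P} (hCU : C ⊆ {x | f x ≠ 0}) (hC : IrredUpper C)
    (hUC : IsUpperSet ({x | f x ≠ 0} \ C)) : b C ≠ 0 := by
  have key : ∀ J, b J ≠ 0 → J ⊆ C ∨ J ∩ C = ∅ := fun J hJ =>
    irred_sub_or hC.1 hUC (h.1 J hJ) (fun x hx => h.pos hJ hx)
  have key2 : ∀ x ∈ C, ∃ J, b J ≠ 0 ∧ x ∈ J ∧ J ⊆ C := by
    intro x hx
    obtain ⟨J, hJ, hxJ⟩ := h.exists_mem (hCU hx)
    refine ⟨J, hJ, hxJ, (key J hJ).resolve_right ?_⟩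
    exact Set.Nonempty.ne_empty ⟨x, hxJ, hx⟩
  obtain ⟨x, hx⟩ := hC.2.1
  obtain ⟨J0, hJ0, _, hJ0C⟩ := key2 x hx
  obtain ⟨I, ⟨hbI, hIC⟩, hmax⟩ :=
    (Set.toFinite {J : Set P | b J ≠ 0 ∧ J ⊆ C}).exists_maximal ⟨J0, hJ0, hJ0C⟩
  by_cases hE : C ⊆ I
  · rwa [Set.Subset.antisymm hE hIC]
  exfalso
  obtain ⟨y, hy, hyI⟩ := Set.not_subset.1 hE
  refine hC.2.2 I (C \ I) (h.1 I hbI).1 ?_ (h.1 I hbI).2.1 ⟨y, hy, hyI⟩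
    Set.disjoint_sdiff_right (Set.union_sdiff_cancel hIC).symm
  rintro u v huv ⟨hu, huI⟩
  obtain ⟨J, hJ, huJ, hJC⟩ := key2 u hu
  have hvJ := (h.1 J hJ).1 huv huJ
  refine ⟨hJC hvJ, fun hvI => ?_⟩
  rcases h.2.1 I J hbI hJ with h1 | h1 | h1
  · exact huI (hmax (y := J) ⟨hJ, hJC⟩ h1 huJ)
  · exact huI (h1 huJ)
  · exact Set.Nonempty.ne_empty (s := I ∩ J) ⟨v, hvI, hvJ⟩ h1

open Classical in
theorem sum_add_single {P : Type*} [Fintype P] (a : Set P → ℕ) (C : Set P) (x : P) :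
    (∑ I : Set P, if x ∈ I then (a + Pi.single C 1 : Set P → ℕ) I else 0) =
      (∑ I : Set P, if x ∈ I then a I else 0) + if x ∈ C then 1 else 0 := by
  have : ∀ I : Set P, (if x ∈ I then (a + Pi.single C 1 : Set P → ℕ) I else 0) =
      (if x ∈ I then a I else 0) + (if I = C then (if x ∈ C then 1 else 0) else 0) := by
    intro I
    by_cases hIC : I = C
    · subst hIC
      by_cases hx : x ∈ I <;> simp [hx]
    · simp [hIC]
  simp only [this, Finset.sum_add_distrib]
  simp

theorem existsUnique_ncDecomp {P : Type*} [Fintype P] [PartialOrder P] (n : ℕ) :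
    ∀ f : P → ℕ, Monotone f → ∑ x, f x = n → ∃! a, NCDecomp f a := by
  classical
  induction n using Nat.strong_induction_on with
  | _ n ih =>
  intro f hf hn
  by_cases hne : ({x | f x ≠ 0} : Set P).Nonempty
  swap
  · have h0 : ∀ x, f x = 0 := by
      intro x
      by_contra hx
      exact hne ⟨x, hx⟩
    refine ⟨0, ⟨by simp, by simp, by simp [h0]⟩, ?_⟩
    intro b hb
    ext I
    by_contra hI
    obtain ⟨x, hx⟩ := (hb.1 I hI).2.1
    exact hb.pos hI hx (h0 x)
  have hU : IsUpperSet ({x | f x ≠ 0} : Set P) := by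
    intro x y hxy hx
    have := hf hxy
    simp only [Set.mem_ofPred_eq] at *
    omega
  obtain ⟨C, hCU, hC, hUC⟩ := exists_component _ hU hne
  obtain ⟨g, hg⟩ : ∃ g : P → ℕ, ∀ x, f x = g x + if x ∈ C then 1 else 0 := by
    refine ⟨fun x => f x - if x ∈ C then 1 else 0, fun x => ?_⟩
    by_cases hx : x ∈ C
    · have : f x ≠ 0 := hCU hx
      simp only [hx, if_true]
      omega
    · simp [hx]
  have hgm : Monotone g := by
    intro x y hxy
    have h1 := hf hxy
    rw [hg x, hg y] at h1
    by_cases hx : x ∈ C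
    · have hy := hC.1 hxy hx
      simpa [hx, hy] using h1
    · by_cases hy : y ∈ C
      · by_cases hfx : f x = 0
        · have := hg x
          omega
        · exact absurd hy (hUC hxy ⟨hfx, hx⟩).2
      · simpa [hx, hy] using h1
  have hlt : ∑ x, g x < n := by
    rw [← hn]
    obtain ⟨x, hx⟩ := hC.2.1
    refine Finset.sum_lt_sum (fun i _ => by rw [hg i]; omega) ⟨x, Finset.mem_univ _, ?_⟩
    rw [hg x]
    simp [hx]
  obtain ⟨a, ha, hau⟩ := ih _ hlt g hgm rfl
  have hsub : ∀ I, a I ≠ 0 → I ⊆ C ∨ I ∩ C = ∅ := by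
    intro I hI
    refine irred_sub_or hC.1 hUC (ha.1 I hI) (fun x hx => ?_)
    have h1 := ha.pos hI hx
    have h2 := hg x
    simp only [Set.mem_ofPred_eq]
    omega
  have hcase : ∀ I, (a + Pi.single C 1 : Set P → ℕ) I ≠ 0 → I = C ∨ a I ≠ 0 := by
    intro I hI
    by_cases hIC : I = C
    · exact Or.inl hIC
    · right
      simpa [hIC] using hI
  refine ⟨a + Pi.single C 1, ⟨?_, ?_, ?_⟩, ?_⟩
  · intro I hI
    rcases hcase I hI with rfl | h
    · exact hC
    · exact ha.1 I h
  · intro I J hI hJ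
    rcases hcase I hI with rfl | h
    · rcases hcase J hJ with rfl | h'
      · exact Or.inl subset_rfl
      · rcases hsub J h' with h | h
        · exact Or.inr (Or.inl h)
        · exact Or.inr (Or.inr (Set.inter_comm _ _ ▸ h))
    · rcases hcase J hJ with rfl | h'
      · rcases hsub I h with h | h
        · exact Or.inl h
        · exact Or.inr (Or.inr h)
      · exact ha.2.1 I J h h'
  · intro x
    rw [hg x, ha.2.2 x]
    convert (sum_add_single a C x).symm
  · intro b hb
    have hbC := hb.comp_ne hCU hC hUC
    obtain ⟨c, rfl⟩ : ∃ c : Set P → ℕ, b = c + Pi.single C 1 := by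
      refine ⟨b - Pi.single C 1, ?_⟩
      ext I
      by_cases hIC : I = C
      · subst hIC
        simp
        omega
      · simp [hIC]
    have hc : ∀ I, c I ≠ 0 → (c + Pi.single C 1 : Set P → ℕ) I ≠ 0 := by
      intro I hI
      simp only [Pi.add_apply]
      omega
    rw [hau c ⟨fun I hI => hb.1 I (hc I hI), fun I J hI hJ => hb.2.1 I J (hc I hI) (hc J hJ), ?_⟩]
    intro x
    have h1 := hb.2.2 x
    have h2 := sum_add_single c C x
    have h3 := hg x
    have h4 : (∑ I : Set P, if x ∈ I then (c + Pi.single C 1 : Set P → ℕ) I else 0) = f x := by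
      rw [h1]
    have h5 : g x = (∑ I : Set P, if x ∈ I then c I else 0) := by
      omega
    rw [h5]

/-- Unique decomposition of a monotone function along a near-chain of irreducible
upper sets, with positive coefficients (encoded as a coefficient function `a`
whose support is the near-chain). -/
theorem stmt4 {P : Type*} [Fintype P] [PartialOrder P]
    (f : P → ℕ) (hf : Monotone f) :
    ∃! a : Set P → ℕ,
      (∀ I : Set P, a I ≠ 0 → IrredUpper I) ∧
      (∀ I J : Set P, a I ≠ 0 → a J ≠ 0 → I ⊆ J ∨ J ⊆ I ∨ I ∩ J = ∅) ∧
      f = ∑ᶠ I : Set P, a I • Set.indicator I (1 : P → ℕ) := by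
  obtain ⟨a, ha, hu⟩ := existsUnique_ncDecomp _ f hf rfl
  exact ⟨a, (ncDecomp_iff f a).1 ha, fun b hb => hu b ((ncDecomp_iff f b).2 hb)⟩
end

section
/- Let I be an irreducible upper set of a finite poset P. If χ_I = Σ_{i=1}^r a_i · χ_{I_i} (as functions P → ℚ) with rational numbers a_i > 0 and irreducible upper sets I_1, …, I_r, then I_i = I for all i. Equivalently, the extremal rays of the cone of nonnegative rational-valued monotone functions on P are exactly the rays spanned by the χ_I for I an irreducible upper set. -/
/-- The indicator functions of irreducible upper sets span extremal rays of the cone of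
nonnegative monotone rational functions: if `χ_I` is a positive combination of
indicators of irreducible upper sets, all of them equal `I`. -/
theorem stmt5 {P : Type*} [Fintype P] [PartialOrder P]
    (I : Set P) (hI : IrredUpper I)
    (r : ℕ) (a : Fin r → ℚ) (Is : Fin r → Set P)
    (ha : ∀ i, 0 < a i) (hIs : ∀ i, IrredUpper (Is i))
    (heq : Set.indicator I (1 : P → ℚ) = ∑ i, a i • Set.indicator (Is i) (1 : P → ℚ)) :
    ∀ i, Is i = I := by
  classical
  intro i
  have hx : ∀ x, (if x ∈ I then (1 : ℚ) else 0) = ∑ j, if x ∈ Is j then a j else 0 := by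
    intro x
    have h := congrFun heq x
    simpa [Set.indicator_apply, Finset.sum_apply] using h
  have hnn : ∀ x, ∀ j ∈ Finset.univ, (0 : ℚ) ≤ if x ∈ Is j then a j else 0 := by
    intro x j _
    split_ifs
    · exact (ha j).le
    · exact le_rfl
  have hsub : Is i ⊆ I := by
    intro x hxi
    by_contra hxI
    have h := hx x
    rw [if_neg hxI] at h
    have h2 := (Finset.sum_eq_zero_iff_of_nonneg (hnn x)).1 h.symm i (Finset.mem_univ i)
    rw [if_pos hxi] at h2
    exact (ha i).ne' h2
  have hup : IsUpperSet (I \ Is i) := by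
    rintro x y hxy ⟨hxI, hxi⟩
    have hyI : y ∈ I := hI.1 hxy hxI
    refine ⟨hyI, fun hyi => ?_⟩
    have h1 := hx x
    have h2 := hx y
    rw [if_pos hxI] at h1
    rw [if_pos hyI] at h2
    have hlt : (∑ j, if x ∈ Is j then a j else 0) < ∑ j, if y ∈ Is j then a j else 0 := by
      apply Finset.sum_lt_sum
      · intro j hj
        by_cases hxj : x ∈ Is j
        · rw [if_pos hxj, if_pos ((hIs j).1 hxy hxj)]
        · rw [if_neg hxj]
          exact hnn y j hj
      · refine ⟨i, Finset.mem_univ i, ?_⟩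
        rw [if_neg hxi, if_pos hyi]
        exact ha i
    rw [← h1, ← h2] at hlt
    exact lt_irrefl _ hlt
  by_contra hne
  have hne2 : (I \ Is i).Nonempty := by
    by_contra h
    rw [Set.not_nonempty_iff_eq_empty, Set.diff_eq_empty] at h
    exact hne (Set.Subset.antisymm hsub h)
  exact hI.2.2 (Is i) (I \ Is i) (hIs i).1 hup (hIs i).2.1 hne2 Set.disjoint_sdiff_right
    (Set.union_diff_cancel hsub).symm
end

section
/- The cover inequalities in the facet description of the cone of nonnegative monotone functions cannot be omitted: for every pair x, y ∈ P with y a cover of x, there exists a function f : P → ℚ that is not monotone, but satisfies f(z) ≥ 0 for every minimal element z of P and f(u) ≤ f(v) for every cover pair (u, v) of P with (u, v) ≠ (x, y). -/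
theorem stmt7 {P : Type*} [Fintype P] [PartialOrder P]
    (x y : P) (hxy : x ⋖ y) :
    ∃ f : P → ℚ, ¬ Monotone f ∧ (∀ z : P, IsMin z → 0 ≤ f z) ∧
      ∀ u v : P, u ⋖ v → (u, v) ≠ (x, y) → f u ≤ f v := by
  classical
  refine ⟨fun z => if x ≤ z ∧ z ≠ y then 1 else 0, ?_, ?_, ?_⟩
  · intro h
    have h1 := h hxy.le
    simp only [le_refl, ne_eq, hxy.ne, not_false_eq_true, and_self, if_true, not_true_eq_false,
      and_false, if_false] at h1
    norm_num at h1
  · intro z _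
    dsimp only
    split_ifs <;> norm_num
  · intro u v huv hne
    dsimp only
    by_cases hu : x ≤ u ∧ u ≠ y
    · have hv : x ≤ v ∧ v ≠ y := by
        refine ⟨hu.1.trans huv.le, ?_⟩
        rintro rfl
        rcases hu.1.eq_or_lt with h | h
        · exact hne (by rw [h])
        · exact hxy.2 h huv.lt
      rw [if_pos hu, if_pos hv]
    · rw [if_neg hu]
      split_ifs <;> norm_num
end

section
/- Let P be a finite poset satisfying: (1) for every x ∈ P, all inextensible chains ascending from x have the same length; and (2) for all maximal elements x ∈ P, the maximal length of a chain descending from x is independent of x. Let m be the (common) maximal length of a chain in P. Then a strictly monotone function γ : P → ℕ∖{0} admits no nonzero monotone function δ : P → ℕ such that γ − δ is again strictly monotone with values in ℕ∖{0} if and only if γ(x_i) = i for every chain x_1 < x_2 < ⋯ < x_m of maximal length in P. -/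
/-- A chain in a poset, given as a finite set of pairwise comparable elements. -/
def IsChainF {P : Type*} [PartialOrder P] (C : Finset P) : Prop :=
  IsChain (· ≤ ·) (↑C : Set P)

/-- A chain ascending from `x`: a chain whose minimum is `x`. -/
def AscFrom {P : Type*} [PartialOrder P] (x : P) (C : Finset P) : Prop :=
  IsChainF C ∧ x ∈ C ∧ ∀ y ∈ C, x ≤ y

/-- A chain descending from `x`: a chain whose maximum is `x`. -/
def DescFrom {P : Type*} [PartialOrder P] (x : P) (C : Finset P) : Prop :=
  IsChainF C ∧ x ∈ C ∧ ∀ y ∈ C, y ≤ x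

/-- An inextensible chain ascending from `x`: it cannot be enlarged to a longer
chain ascending from `x`. -/
def InextAsc {P : Type*} [PartialOrder P] (x : P) (C : Finset P) : Prop :=
  AscFrom x C ∧ ∀ C' : Finset P, AscFrom x C' → C ⊆ C' → C' = C

theorem chain_enum {P : Type*} [PartialOrder P] (m : ℕ) (γ : P → ℕ) (hγ : StrictMono γ)
    (C : Finset P) (hC : IsChainF C) (hcard : C.card = m) :
    ∃ c : Fin m → P, StrictMono c ∧ ∀ y ∈ C, ∃ i, c i = y := by
  classical
  have hinj : Set.InjOn γ (↑C : Set P) := by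
    intro a ha b hb hab
    by_contra hne
    rcases hC ha hb hne with h | h
    · exact absurd hab (hγ (lt_of_le_of_ne h hne)).ne
    · exact absurd hab (hγ (lt_of_le_of_ne h (Ne.symm hne))).ne'
  have hc : (C.image γ).card = m := by rw [Finset.card_image_of_injOn hinj, hcard]
  let e := (C.image γ).orderEmbOfFin hc
  have he : ∀ i, ∃ x ∈ C, γ x = e i := fun i => by
    have := (C.image γ).orderEmbOfFin_mem hc i
    exact Finset.mem_image.mp this
  choose c hcC hce using he
  refine ⟨c, ?_, ?_⟩
  · intro i j hij
    have h3 : γ (c i) < γ (c j) := by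
      rw [hce, hce]; exact e.strictMono hij
    have hne : c i ≠ c j := fun h => by rw [h] at h3; exact lt_irrefl _ h3
    rcases hC (hcC i) (hcC j) hne with h | h
    · exact lt_of_le_of_ne h hne
    · exact absurd (hγ.monotone h) (not_le.mpr h3)
  · intro y hy
    have : γ y ∈ Set.range e := by
      rw [Finset.range_orderEmbOfFin]
      simpa using ⟨y, hy, rfl⟩
    obtain ⟨i, hi⟩ := this
    exact ⟨i, hinj (hcC i) hy (by rw [hce, hi])⟩

theorem chain_lower {P : Type*} [PartialOrder P] (m : ℕ) (γ : P → ℕ) (hγ : StrictMono γ)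
    (hpos : ∀ x, 0 < γ x) (c : Fin m → P) (hc : StrictMono c) (i : Fin m) :
    (i : ℕ) + 1 ≤ γ (c i) := by
  obtain ⟨k, hk⟩ := i
  induction k with
  | zero => exact hpos _
  | succ k ih =>
    have h1 := ih (by omega)
    have h2 : γ (c ⟨k, by omega⟩) < γ (c ⟨k+1, hk⟩) := hγ (hc (by simp [Fin.lt_def]))
    simp only at h1 ⊢
    omega

theorem chain_insert {P : Type*} [PartialOrder P] [DecidableEq P] (C : Finset P) (x : P)
    (hC : IsChainF C) (h : ∀ y ∈ C, x ≤ y ∨ y ≤ x) : IsChainF (insert x C) := by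
  unfold IsChainF
  rw [Finset.coe_insert]
  exact hC.insert fun y hy _ => h y hy

theorem exists_height {P : Type*} [Fintype P] [PartialOrder P] (x : P) :
    ∃ C : Finset P, InextAsc x C ∧ ∀ D, AscFrom x D → D.card ≤ C.card := by
  classical
  obtain ⟨C, hC, hmax⟩ := Finset.exists_max_image
    (Finset.univ.filter fun C : Finset P => AscFrom x C) Finset.card
    ⟨{x}, Finset.mem_filter.mpr ⟨Finset.mem_univ _, by simp [AscFrom, IsChainF]⟩⟩
  simp only [Finset.mem_filter, Finset.mem_univ, true_and] at hC hmax
  exact ⟨C, ⟨hC, fun D hD hCD => (Finset.eq_of_subset_of_card_le hCD (hmax D hD)).symm⟩, hmax⟩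

theorem inext_insert {P : Type*} [PartialOrder P] [DecidableEq P] (x y : P) (hxy : x ⋖ y)
    (C : Finset P) (hC : InextAsc y C) : InextAsc x (insert x C) := by
  obtain ⟨⟨hch, hyC, hmin⟩, hmax⟩ := hC
  have hle : ∀ z ∈ C, x ≤ z := fun z hz => hxy.le.trans (hmin z hz)
  refine ⟨⟨chain_insert C x hch fun z hz => Or.inl (hle z hz), by simp, ?_⟩, ?_⟩
  · intro z hz
    rcases Finset.mem_insert.mp hz with rfl | hz
    · exact le_rfl
    · exact hle z hz
  · rintro D ⟨hDch, hxD, hDmin⟩ hsub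
    have hyD : y ∈ D := hsub (by simp [hyC])
    have hge : ∀ z ∈ D, z ≠ x → y ≤ z := by
      intro z hz hzx
      by_contra hn
      have hzy : z ≤ y := by
        rcases eq_or_ne z y with h | h
        · exact h.le
        · rcases hDch hz hyD h with h | h
          · exact h
          · exact absurd h hn
      exact hxy.2 (lt_of_le_of_ne (hDmin z hz) (Ne.symm hzx))
        (lt_of_le_not_ge hzy hn)
    have hxC : x ∉ C := fun h => absurd (hmin x h) (not_le_of_gt hxy.lt)
    have := hmax (D.erase x) ⟨hDch.mono (by simp), by simp [hyD, hxy.lt.ne'], ?_⟩ ?_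
    · rw [← this, Finset.insert_erase hxD]
    · intro z hz
      have := Finset.mem_erase.mp hz
      exact hge z this.2 this.1
    · intro z hz
      exact Finset.mem_erase.mpr ⟨fun h => hxC (h ▸ hz), hsub (by simp [hz])⟩

theorem stmt8 {P : Type*} [Fintype P] [PartialOrder P] (m : ℕ)
    (h1 : ∀ x : P, ∀ C C' : Finset P, InextAsc x C → InextAsc x C' → C.card = C'.card)
    (h2 : ∃ d : ℕ, ∀ x : P, IsMax x →
      IsGreatest {l : ℕ | ∃ C : Finset P, DescFrom x C ∧ C.card = l} d)
    (hm : IsGreatest {l : ℕ | ∃ C : Finset P, IsChainF C ∧ C.card = l} m)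
    (γ : P → ℕ) (hγ : StrictMono γ) (hγpos : ∀ x, 0 < γ x) :
    (¬∃ δ γ' : P → ℕ, Monotone δ ∧ δ ≠ 0 ∧ StrictMono γ' ∧ (∀ x, 0 < γ' x) ∧ γ = γ' + δ) ↔
      ∀ c : Fin m → P, StrictMono c → ∀ i : Fin m, γ (c i) = (i : ℕ) + 1 := by
  classical
  constructor
  · intro hno c hc i
    by_contra hne
    have hgt : (i : ℕ) + 1 < γ (c i) :=
      lt_of_le_of_ne (chain_lower m γ hγ hγpos c hc i) (Ne.symm hne)
    apply hno
    choose K hK hKmax using (exists_height (P := P))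
    have hKle : ∀ x, (K x).card ≤ m := fun x => hm.2 ⟨K x, (hK x).1.1, rfl⟩
    have hlt : ∀ x y, x < y → (K y).card + 1 ≤ (K x).card := by
      intro x y hxy
      obtain ⟨⟨hch, hyC, hmin⟩, -⟩ := hK y
      have hxC : x ∉ K y := fun h => absurd (hmin x h) (not_le_of_gt hxy)
      have := hKmax x (insert x (K y))
        ⟨chain_insert _ _ hch fun z hz => Or.inl (hxy.le.trans (hmin z hz)), by simp, by
          intro z hz
          rcases Finset.mem_insert.mp hz with rfl | hz
          · exact le_rfl
          · exact hxy.le.trans (hmin z hz)⟩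
      rwa [Finset.card_insert_of_notMem hxC] at this
    have hmono : Monotone fun x => γ x + (K x).card := by
      letI : LocallyFiniteOrder P := Fintype.toLocallyFiniteOrder
      rw [monotone_iff_forall_covBy]
      intro x y hxy
      have h := h1 x _ _ (hK x) (inext_insert x y hxy _ (hK y))
      have h' := Finset.card_insert_le x (K y)
      have := hγ hxy.lt
      omega
    have hci : m - i ≤ (K (c i)).card := by
      have := hKmax (c i) ((Finset.Ici i).image c) ⟨?_, Finset.mem_image.mpr ⟨i, by simp, rfl⟩, ?_⟩
      · rwa [Finset.card_image_of_injective _ hc.injective, Fin.card_Ici] at this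
      · intro a ha b hb _
        simp only [Finset.coe_image, Set.mem_image] at ha hb
        obtain ⟨j, -, rfl⟩ := ha
        obtain ⟨k, -, rfl⟩ := hb
        exact (le_total j k).imp (fun h => hc.monotone h) (fun h => hc.monotone h)
      · intro y hy
        simp only [Finset.mem_image, Finset.mem_Ici] at hy
        obtain ⟨j, hj, rfl⟩ := hy
        exact hc.monotone hj
    let δ : P → ℕ := fun x => if m + 1 < γ x + (K x).card then 1 else 0
    have hδle : ∀ x, δ x < γ x := by
      intro x
      have := hKle x
      have := hγpos x
      simp only [δ]
      split_ifs <;> omega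
    refine ⟨δ, fun x => γ x - δ x, ?_, ?_, ?_, ?_, ?_⟩
    · intro x y hxy
      have := hmono hxy
      simp only [δ] at this ⊢
      split_ifs <;> omega
    · intro h
      have := congrFun h (c i)
      have hi := i.2
      simp only [δ, Pi.zero_apply] at this
      split_ifs at this
      omega
    · intro x y hxy
      have a := hlt x y hxy
      have b := hγ hxy
      have c1 := hδle x
      have d := hδle y
      have e := hmono hxy.le
      simp only [δ] at c1 d e ⊢
      split_ifs at * <;> omega
    · intro x
      have := hδle x
      simp only
      omega
    · funext x
      have := hδle x
      simp only [Pi.add_apply]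
      omega
  · rintro hall ⟨δ, γ', hδ, hδ0, hγ', hγ'pos, heq⟩
    obtain ⟨x, hx⟩ := Function.ne_iff.mp hδ0
    obtain ⟨y, hxy, hy⟩ := Finite.exists_le_maximal (p := fun _ : P => True) (a := x) trivial
    have hymax : IsMax y := fun z hz => hy.2 trivial hz
    have hδy : 0 < δ y := lt_of_lt_of_le (Nat.pos_of_ne_zero hx) (hδ hxy)
    obtain ⟨d, hd⟩ := h2
    obtain ⟨C, hC, hCm⟩ := hm.1
    have hm1 : 1 ≤ m := hm.2 ⟨{y}, by simp [IsChainF], by simp⟩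
    have hCne : C.Nonempty := Finset.card_pos.mp (by omega)
    obtain ⟨t, ht⟩ := C.exists_maximal hCne
    have htop : ∀ z ∈ C, z ≤ t := by
      intro z hz
      rcases eq_or_ne z t with h | h
      · exact h.le
      · rcases hC hz ht.1 h with h | h
        · exact h
        · exact ht.2 hz h
    have htmax : IsMax t := by
      intro z hz
      by_contra hn
      have hzC : z ∉ C := fun h => hn (htop z h)
      have := hm.2 ⟨insert z C,
        chain_insert C z hC fun w hw => Or.inr ((htop w hw).trans hz), rfl⟩
      rw [Finset.card_insert_of_notMem hzC] at this
      omega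
    have hmd : m ≤ d := (hd t htmax).2 ⟨C, ⟨hC, ht.1, htop⟩, hCm⟩
    obtain ⟨C', hC', hC'd⟩ := (hd y hymax).1
    have hdm : d ≤ m := hm.2 ⟨C', hC'.1, hC'd⟩
    obtain ⟨c, hc, hcs⟩ := chain_enum m γ hγ C' hC'.1 (by omega)
    obtain ⟨i, rfl⟩ := hcs y hC'.2.1
    have a := hall c hc i
    have b := chain_lower m γ' hγ' hγ'pos c hc i
    rw [heq] at a
    simp only [Pi.add_apply] at a
    omega
end

section
/- Let f be an irreducible element of the monoid M(P) of monotone ℕ-valued functions on a finite poset P. If the support supp(f) = {p ∈ P : f(p) ≠ 0} is not contained in the union of the supports of the other irreducible elements of M(P), then f is a prime element of M(P). -/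
/-- `f` divides `g` in the monoid `M(P)` of monotone functions `P → ℕ`. -/
def DividesM {P : Type*} [PartialOrder P] (f g : P → ℕ) : Prop :=
  ∃ h : P → ℕ, Monotone h ∧ g = f + h

/-- `f` is a prime element of the monoid `M(P)` of monotone functions `P → ℕ`. -/
def PrimeM {P : Type*} [PartialOrder P] (f : P → ℕ) : Prop :=
  Monotone f ∧ f ≠ 0 ∧ ∀ g h : P → ℕ, Monotone g → Monotone h →
    DividesM f (g + h) → DividesM f g ∨ DividesM f h

/-- `f` is an irreducible element of the monoid `M(P)`: it is nonzero and is not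
the sum of two nonzero monotone functions. -/
def IrredElem {P : Type*} [PartialOrder P] (f : P → ℕ) : Prop :=
  Monotone f ∧ f ≠ 0 ∧
    ∀ g h : P → ℕ, Monotone g → Monotone h → g ≠ 0 → h ≠ 0 → f ≠ g + h

theorem exists_irred_dvd {P : Type*} [Fintype P] [PartialOrder P] (p : P) (n : ℕ) :
    ∀ g : P → ℕ, Monotone g → g p ≠ 0 → ∑ x, g x ≤ n →
      ∃ k : P → ℕ, IrredElem k ∧ k p ≠ 0 ∧ DividesM k g := by
  have pos : ∀ a : P → ℕ, a ≠ 0 → 0 < ∑ x, a x := by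
    intro a ha
    rw [Nat.pos_iff_ne_zero]
    intro h0
    apply ha
    funext x
    exact (Finset.sum_eq_zero_iff.mp h0) x (Finset.mem_univ x)
  induction n with
  | zero =>
    intro g _ hp hs
    have := pos g (fun h => hp (by simp [h]))
    omega
  | succ n ih =>
    intro g hg hp hs
    by_cases hi : IrredElem g
    · exact ⟨g, hi, hp, 0, monotone_const, by simp⟩
    · have hg0 : g ≠ 0 := fun h => hp (by simp [h])
      have hex : ∃ a b : P → ℕ, Monotone a ∧ Monotone b ∧ a ≠ 0 ∧ b ≠ 0 ∧ g = a + b := by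
        by_contra hc
        exact hi ⟨hg, hg0, fun a b ha hb ha0 hb0 he => hc ⟨a, b, ha, hb, ha0, hb0, he⟩⟩
      obtain ⟨a, b, ha, hb, ha0, hb0, rfl⟩ := hex
      have h1 := pos a ha0
      have h2 := pos b hb0
      simp only [Pi.add_apply, Finset.sum_add_distrib] at hs hp
      by_cases hap : a p = 0
      · obtain ⟨k, hk, hkp, c, hc, rfl⟩ := ih b hb (by omega) (by omega)
        exact ⟨k, hk, hkp, a + c, ha.add hc, by rw [add_left_comm]⟩
      · obtain ⟨k, hk, hkp, c, hc, rfl⟩ := ih a ha hap (by omega)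
        exact ⟨k, hk, hkp, c + b, hc.add hb, by rw [add_assoc]⟩

theorem stmt10 {P : Type*} [Fintype P] [PartialOrder P]
    (f : P → ℕ) (hf : IrredElem f)
    (hsupp : ¬ ({p : P | f p ≠ 0} ⊆
      {p : P | ∃ g : P → ℕ, IrredElem g ∧ g ≠ f ∧ g p ≠ 0})) :
    PrimeM f := by
  obtain ⟨p, hp, hn⟩ := Set.not_subset.mp hsupp
  have key : ∀ g : P → ℕ, Monotone g → g p ≠ 0 → DividesM f g := by
    intro g hg hgp
    obtain ⟨k, hk, hkp, hd⟩ := exists_irred_dvd p _ g hg hgp le_rfl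
    have hkf : k = f := by
      by_contra hne
      exact hn ⟨k, hk, hne, hkp⟩
    exact hkf ▸ hd
  refine ⟨hf.1, hf.2.1, ?_⟩
  rintro g h hg hh ⟨c, _, hc⟩
  by_cases hgp : g p = 0
  · right
    apply key h hh
    have := congrFun hc p
    simp only [Pi.add_apply] at this
    have hp' : f p ≠ 0 := hp
    omega
  · exact Or.inl (key g hg hgp)
end

section
/- If a finite partially ordered set P has a minimum element, then the constant function χ_P ≡ 1 is a prime element of the monoid M(P). -/
theorem stmt11 {P : Type*} [Fintype P] [PartialOrder P]
    (hmin : ∃ b : P, ∀ x : P, b ≤ x) :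
    PrimeM (fun _ : P => 1) := by
  obtain ⟨b, hb⟩ := hmin
  have key : ∀ g : P → ℕ, Monotone g → 1 ≤ g b → DividesM (fun _ : P => 1) g := by
    intro g hg h1
    refine ⟨fun x => g x - 1, fun x y hxy => Nat.sub_le_sub_right (hg hxy) 1, ?_⟩
    funext x
    have := hg (hb x)
    simp only [Pi.add_apply]
    omega
  refine ⟨monotone_const, fun h => absurd (congrFun h b) one_ne_zero, ?_⟩
  rintro g h hg hh ⟨k, -, hk⟩
  have hkb := congrFun hk b
  simp only [Pi.add_apply] at hkb
  by_cases h1 : 1 ≤ g b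
  · exact Or.inl (key g hg h1)
  · exact Or.inr (key h hh (by omega))
end

section
/- A matroid (E, rk) on a finite set E is uniform — that is, rk(A) = min(|A|, rk(E)) for all A ⊆ E — if and only if it has no nontrivial molecule. -/
/-- A molecule of a matroid with rank function `rk`: a triple of pairwise disjoint
subsets `(R, F, T)` such that `rk A = rk R + |A ∩ F|` for all `A` with
`R ⊆ A ⊆ R ∪ F ∪ T`. -/
def IsMolecule {E : Type*} [DecidableEq E] (rk : Finset E → ℕ) (R F T : Finset E) : Prop :=
  Disjoint R F ∧ Disjoint R T ∧ Disjoint F T ∧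
    ∀ A : Finset E, R ⊆ A → A ⊆ R ∪ F ∪ T → rk A = rk R + (A ∩ F).card

theorem stmt13 {E : Type*} [Fintype E] [DecidableEq E] (rk : Finset E → ℕ)
    (hR1 : ∀ X : Finset E, rk X ≤ X.card)
    (hR2 : ∀ X Y : Finset E, X ⊆ Y → rk X ≤ rk Y)
    (hR3 : ∀ X Y : Finset E, rk (X ∪ Y) + rk (X ∩ Y) ≤ rk X + rk Y) :
    (∀ A : Finset E, rk A = min A.card (rk Finset.univ)) ↔
      ¬∃ R F T : Finset E, IsMolecule rk R F T ∧ F.Nonempty ∧ T.Nonempty := by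
  constructor
  · rintro hU ⟨R, F, T, ⟨hRF, hRT, hFT, h⟩, ⟨f, hf⟩, ⟨t, ht⟩⟩
    have hfR : f ∉ R := Finset.disjoint_right.1 hRF hf
    have htR : t ∉ R := Finset.disjoint_right.1 hRT ht
    have htF : t ∉ F := Finset.disjoint_right.1 hFT ht
    have h1 := h (insert f R) (Finset.subset_insert _ _) (by
      intro x hx; simp only [Finset.mem_insert, Finset.mem_union] at *
      rcases hx with rfl | hx <;> tauto)
    have h2 := h (insert t R) (Finset.subset_insert _ _) (by
      intro x hx; simp only [Finset.mem_insert, Finset.mem_union] at *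
      rcases hx with rfl | hx <;> tauto)
    have e1 : insert f R ∩ F = {f} := by
      rw [Finset.insert_inter_of_mem hf, Finset.disjoint_iff_inter_eq_empty.1 hRF]; rfl
    have e2 : insert t R ∩ F = ∅ := by
      rw [Finset.insert_inter_of_notMem htF, Finset.disjoint_iff_inter_eq_empty.1 hRF]
    rw [e1, hU, hU R, Finset.card_insert_of_notMem hfR, Finset.card_singleton] at h1
    rw [e2, hU, hU R, Finset.card_insert_of_notMem htR, Finset.card_empty] at h2
    omega
  · intro hN A
    induction A using Finset.strongInduction with
    | H A ih =>
    by_contra hne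
    have hA1 := hR1 A
    have hA2 := hR2 A _ (Finset.subset_univ A)
    have hc : rk A < A.card := by omega
    have hr : rk A < rk Finset.univ := by omega
    obtain ⟨t, ht⟩ : A.Nonempty := Finset.card_pos.1 (by omega)
    have hcard := Finset.card_erase_add_one ht
    have ihR := ih _ (Finset.erase_ssubset ht)
    have hRA := hR2 _ _ (Finset.erase_subset t A)
    obtain ⟨e, he⟩ : ∃ e, rk A < rk (insert e A) := by
      by_contra hcon
      push Not at hcon
      have key : ∀ S : Finset E, rk (A ∪ S) ≤ rk A := by
        intro S
        induction S using Finset.induction_on with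
        | empty => simp
        | insert a S _ ihS =>
          have h3 := hR3 (A ∪ S) (insert a A)
          have h4 : (A ∪ S) ∪ insert a A = A ∪ insert a S := by
            ext x; simp only [Finset.mem_union, Finset.mem_insert]; tauto
          have h5 : A ⊆ (A ∪ S) ∩ insert a A := by
            intro x hx; simp [hx]
          have h6 := hR2 _ _ h5
          have h7 := hcon a
          rw [h4] at h3
          omega
      have := key Finset.univ
      rw [Finset.union_eq_right.2 (Finset.subset_univ A)] at this
      omega
    have heA : e ∉ A := fun h => by
      rw [Finset.insert_eq_of_mem h] at he; exact lt_irrefl _ he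
    have hte : t ≠ e := fun h => heA (h ▸ ht)
    have heR : e ∉ A.erase t := fun h => heA (Finset.mem_of_mem_erase h)
    have hRe := hR1 (insert e (A.erase t))
    rw [Finset.card_insert_of_notMem heR] at hRe
    have h8 := hR3 (insert e (A.erase t)) A
    have h9 : insert e (A.erase t) ∪ A = insert e A := by
      ext x; simp only [Finset.mem_union, Finset.mem_insert, Finset.mem_erase]; tauto
    have h10 : A.erase t ⊆ insert e (A.erase t) ∩ A := by
      intro x hx
      have := Finset.mem_of_mem_erase hx
      simp only [Finset.mem_inter, Finset.mem_insert]; tauto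
    have h11 := hR2 _ _ h10
    rw [h9] at h8
    have h12 := hR3 A {e}
    have h13 := hR1 {e}
    rw [Finset.card_singleton] at h13
    have h14 : A ∪ {e} = insert e A := by
      ext x; simp only [Finset.mem_union, Finset.mem_insert, Finset.mem_singleton]; tauto
    rw [h14] at h12
    refine hN ⟨A.erase t, {e}, {t}, ⟨?_, ?_, ?_, ?_⟩, by simp, by simp⟩
    · simpa using fun _ => heA
    · simp
    · simpa using hte.symm
    · intro B hB1 hB2
      have hB3 : ∀ x, x ∈ B → x ∈ A ∨ x = e := by
        intro x hx
        have := hB2 hx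
        simp only [Finset.mem_union, Finset.mem_erase, Finset.mem_singleton] at this
        rcases this with (h | h) | h
        · exact Or.inl h.2
        · exact Or.inr h
        · exact Or.inl (h ▸ ht)
      by_cases heB : e ∈ B
      · have hi : B ∩ {e} = {e} := by simpa using heB
        have u := hR2 _ _ (Finset.insert_subset heB hB1)
        have v := hR2 B (insert e A) (fun x hx => by
          have := hB3 x hx
          simp only [Finset.mem_insert]; tauto)
        rw [hi, Finset.card_singleton]
        omega
      · have hi : B ∩ {e} = ∅ := Finset.inter_singleton_of_notMem heB
        have u := hR2 _ _ hB1
        have v := hR2 B A (fun x hx => (hB3 x hx).resolve_right (fun h => heB (h ▸ hx)))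
        rw [hi, Finset.card_empty]
        omega
end

section
/- Let M = U(k, n) be the uniform matroid on an n-element set E, and let p be a prime number. A function g : 2^E → ℕ arises as g(A) = v_p(m(A)) for some multiplicity function m : 2^E → ℕ∖{0} satisfying axioms (A1) and (A2) on M, if and only if g is monotone with respect to the partial order on 2^E given by the reflexive–transitive closure of the digraph G_M (i.e., g(A) ≤ g(B) whenever there is a directed path in G_M from A to B). -/
/-- The edge relation of the digraph `G_M` of a matroid with rank function `rk`. -/
def MEdge {E : Type*} [DecidableEq E] (rk : Finset E → ℕ) (A B : Finset E) : Prop :=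
  (∃ e ∉ A, B = insert e A ∧ rk A < rk B) ∨
    (∃ e ∉ B, A = insert e B ∧ rk A = rk B)

theorem stmt16 {E : Type*} [Fintype E] [DecidableEq E]
    (k : ℕ) (hk : k ≤ Fintype.card E)
    (rk : Finset E → ℕ) (hrk : ∀ A : Finset E, rk A = min A.card k)
    (p : ℕ) (hp : p.Prime) (g : Finset E → ℕ) :
    (∃ m : Finset E → ℕ, (∀ A : Finset E, 0 < m A) ∧
      (∀ (A : Finset E) (e : E),
        (rk A < rk (insert e A) → m A ∣ m (insert e A)) ∧
        (rk (insert e A) = rk A → m (insert e A) ∣ m A)) ∧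
      (∀ R F T : Finset E, IsMolecule rk R F T →
        m R * m (R ∪ F ∪ T) = m (R ∪ F) * m (R ∪ T)) ∧
      ∀ A : Finset E, g A = (m A).factorization p) ↔
    ∀ A B : Finset E, Relation.ReflTransGen (MEdge rk) A B → g A ≤ g B := by
  constructor
  · rintro ⟨m, hpos, h1, -, hg⟩ A B hAB
    induction hAB with
    | refl => exact le_rfl
    | tail _ hbc ih =>
      refine ih.trans ?_
      rw [hg, hg]
      rcases hbc with ⟨e, _, rfl, hlt⟩ | ⟨e, _, rfl, heq⟩
      · exact (Nat.factorization_le_iff_dvd (hpos _).ne' (hpos _).ne').2 ((h1 _ e).1 hlt) p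
      · exact (Nat.factorization_le_iff_dvd (hpos _).ne' (hpos _).ne').2 ((h1 _ e).2 heq) p
  · intro hmono
    refine ⟨fun A => p ^ g A, fun A => pow_pos hp.pos _, ?_, ?_, ?_⟩
    · intro A e
      by_cases he : e ∈ A
      · simp [Finset.insert_eq_of_mem he]
      · exact ⟨fun h => pow_dvd_pow p (hmono _ _ (.single (Or.inl ⟨e, he, rfl, h⟩))),
          fun h => pow_dvd_pow p (hmono _ _ (.single (Or.inr ⟨e, he, rfl, h⟩)))⟩
    · rintro R F T ⟨hRF, hRT, hFT, h⟩
      rcases F.eq_empty_or_nonempty with rfl | ⟨f, hf⟩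
      · simp
      rcases T.eq_empty_or_nonempty with rfl | ⟨t, ht⟩
      · simp [mul_comm]
      exfalso
      have hfR : f ∉ R := fun hh => Finset.disjoint_left.1 hRF hh hf
      have htR : t ∉ R := fun hh => Finset.disjoint_left.1 hRT hh ht
      have htF : t ∉ F := fun hh => Finset.disjoint_left.1 hFT hh ht
      have hRF0 : R ∩ F = ∅ := Finset.disjoint_iff_inter_eq_empty.1 hRF
      have a := h (insert f R) (Finset.subset_insert _ _) (by
        intro x hx
        simp only [Finset.mem_insert, Finset.mem_union] at hx ⊢
        rcases hx with rfl | hx <;> tauto)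
      have b := h (insert t R) (Finset.subset_insert _ _) (by
        intro x hx
        simp only [Finset.mem_insert, Finset.mem_union] at hx ⊢
        rcases hx with rfl | hx <;> tauto)
      rw [Finset.insert_inter_of_mem hf, hRF0, hrk, hrk, Finset.card_insert_of_notMem hfR] at a
      rw [Finset.insert_inter_of_notMem htF, hRF0, hrk, hrk,
        Finset.card_insert_of_notMem htR] at b
      simp at a b
      omega
    · intro A
      simp [hp.factorization_self]
end

section
/- Let n be a positive integer, 0 ≤ k ≤ n, and let P_{k,n} be the poset on the subsets of an n-element set E given by the reflexive–transitive closure of the digraph G_{U(k,n)}. Then P_{k,n} is graded — i.e., there exists a level function γ : P_{k,n} → ℤ with γ(x) = 1 for every minimal element x and γ(y) = γ(x) + 1 whenever y covers x — if and only if k = 0, 2k = n, or k = n. -/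
theorem medge_iff_aux {E : Type*} [DecidableEq E] (k : ℕ)
    (rk : Finset E → ℕ) (hrk : ∀ A : Finset E, rk A = min A.card k) {A B : Finset E}
    (h : MEdge rk A B) :
    (B.card = A.card + 1 ∧ A.card < k) ∨ (A.card = B.card + 1 ∧ k ≤ B.card) := by
  rcases h with ⟨e, he, rfl, h⟩ | ⟨e, he, rfl, h⟩
  · rw [hrk, hrk, Finset.card_insert_of_notMem he] at h
    rw [Finset.card_insert_of_notMem he]
    omega
  · rw [hrk, hrk, Finset.card_insert_of_notMem he] at h
    rw [Finset.card_insert_of_notMem he]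
    omega

theorem medge_path_aux {E : Type*} [DecidableEq E] (k : ℕ)
    (rk : Finset E → ℕ) (hrk : ∀ A : Finset E, rk A = min A.card k) {A B : Finset E}
    (h : Relation.ReflTransGen (MEdge rk) A B) :
    A = B ∨ (B.card - k) + (k - B.card) < (A.card - k) + (k - A.card) := by
  induction h with
  | refl => exact Or.inl rfl
  | tail _ h2 ih =>
    right
    have := medge_iff_aux k rk hrk h2
    rcases ih with rfl | ih <;> omega

theorem stmt17 {E : Type*} [Fintype E] [DecidableEq E]
    (hn : 0 < Fintype.card E)
    (k : ℕ) (hk : k ≤ Fintype.card E)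
    (rk : Finset E → ℕ) (hrk : ∀ A : Finset E, rk A = min A.card k) :
    (∃ γ : Finset E → ℤ,
      (∀ A : Finset E,
        (¬∃ B : Finset E, B ≠ A ∧ Relation.ReflTransGen (MEdge rk) B A) → γ A = 1) ∧
      (∀ A B : Finset E,
        (Relation.ReflTransGen (MEdge rk) A B ∧ A ≠ B ∧
          ¬∃ C : Finset E, C ≠ A ∧ C ≠ B ∧
            Relation.ReflTransGen (MEdge rk) A C ∧ Relation.ReflTransGen (MEdge rk) C B) →
        γ B = γ A + 1)) ↔
    (k = 0 ∨ 2 * k = Fintype.card E ∨ k = Fintype.card E) := by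
  constructor
  · rintro ⟨γ, h1, h2⟩
    by_contra hcon
    have step : ∀ A B : Finset E, MEdge rk A B → γ B = γ A + 1 := by
      intro A B h
      have hc := medge_iff_aux k rk hrk h
      refine h2 A B ⟨Relation.ReflTransGen.single h, ?_, ?_⟩
      · rintro rfl
        omega
      · rintro ⟨C, hCA, hCB, hAC, hCB'⟩
        have a := (medge_path_aux k rk hrk hAC).resolve_left (Ne.symm hCA)
        have b := (medge_path_aux k rk hrk hCB').resolve_left hCB
        omega
    have low : ∀ A : Finset E, A.card ≤ k → γ A = A.card + 1 := by
      intro A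
      induction A using Finset.induction_on with
      | empty =>
        intro _
        rw [h1]
        · simp
        · rintro ⟨B, hB, hp⟩
          rcases Relation.ReflTransGen.cases_tail hp with h | ⟨C, _, hC⟩
          · exact hB h.symm
          · have := medge_iff_aux k rk hrk hC
            rw [Finset.card_empty] at this
            omega
      | insert e A he ih =>
        intro hA
        rw [Finset.card_insert_of_notMem he] at hA ⊢
        rw [step A (insert e A) (Or.inl ⟨e, he, rfl, by
          rw [hrk, hrk, Finset.card_insert_of_notMem he]; omega⟩), ih (by omega)]
        push_cast
        ring
    have high : ∀ m : ℕ, ∀ A : Finset E, k ≤ A.card → A.card + m = Fintype.card E →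
        γ A = m + 1 := by
      intro m
      induction m with
      | zero =>
        intro A _ hA
        rw [h1]
        · simp
        · rintro ⟨B, hB, hp⟩
          rcases Relation.ReflTransGen.cases_tail hp with h | ⟨C, _, hC⟩
          · exact hB h.symm
          · have := medge_iff_aux k rk hrk hC
            have := Finset.card_le_univ C
            omega
      | succ m ih =>
        intro A hk' hA
        have : ∃ e, e ∉ A := by
          by_contra! hall
          have : A = Finset.univ := Finset.eq_univ_iff_forall.2 hall
          rw [this, Finset.card_univ] at hA
          omega
        obtain ⟨e, he⟩ := this
        have hc := Finset.card_insert_of_notMem he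
        rw [step (insert e A) A (Or.inr ⟨e, he, rfl, by
          rw [hrk, hrk, hc]; omega⟩), ih (insert e A) (by omega) (by omega)]
        push_cast
        ring
    obtain ⟨A, _, hA⟩ := Finset.exists_subset_card_eq
      (s := (Finset.univ : Finset E)) (n := k) (by rwa [Finset.card_univ])
    have a := low A hA.le
    have b := high (Fintype.card E - k) A hA.ge (by omega)
    omega
  · intro hcase
    refine ⟨fun A => if (A.card ≤ k ∧ k ≠ 0) then (A.card : ℤ) + 1
      else (Fintype.card E : ℤ) - A.card + 1, ?_, ?_⟩
    · intro A hmin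
      have key : ∀ B, ¬ MEdge rk B A := by
        intro B hB
        refine hmin ⟨B, ?_, Relation.ReflTransGen.single hB⟩
        rintro rfl
        have := medge_iff_aux k rk hrk hB
        omega
      have hAn := Finset.card_le_univ A
      have hlow : A.card = 0 ∨ k < A.card ∨ k = 0 := by
        by_contra! hc
        obtain ⟨e, he⟩ := Finset.card_pos.1 (Nat.pos_of_ne_zero hc.1)
        have hce := Finset.card_erase_add_one he
        exact key (A.erase e) (Or.inl ⟨e, Finset.notMem_erase e A,
          (Finset.insert_erase he).symm, by rw [hrk, hrk]; omega⟩)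
      have hhigh : A.card = Fintype.card E ∨ A.card < k := by
        by_contra! hc
        have : ∃ e, e ∉ A := by
          by_contra! hall
          have : A = Finset.univ := Finset.eq_univ_iff_forall.2 hall
          exact hc.1 (by rw [this, Finset.card_univ])
        obtain ⟨e, he⟩ := this
        have hce := Finset.card_insert_of_notMem he
        exact key (insert e A) (Or.inr ⟨e, he, rfl, by rw [hrk, hrk]; omega⟩)
      dsimp only
      split_ifs <;> omega
    · rintro A B ⟨hp, hne, hno⟩
      have hedge : MEdge rk A B := by
        rcases Relation.ReflTransGen.cases_head hp with h | ⟨C, hC, hCB⟩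
        · exact absurd h hne
        · by_cases hCB' : C = B
          · exact hCB' ▸ hC
          · refine absurd ⟨C, ?_, hCB', Relation.ReflTransGen.single hC, hCB⟩ hno
            rintro rfl
            have := medge_iff_aux k rk hrk hC
            omega
      have hc := medge_iff_aux k rk hrk hedge
      have := Finset.card_le_univ A
      have := Finset.card_le_univ B
      dsimp only
      split_ifs <;> omega
end

section
/- Let n ≥ 2 and let P_{n−1,n} be the poset on the subsets of an n-element set E given by the reflexive–transitive closure of the digraph G_{U(n−1,n)}. Consider the monoid M(P_{n−1,n}) of monotone ℕ-valued functions on P_{n−1,n}. Then the set of functions g ∈ M(P_{n−1,n}) that are strictly monotone with all values positive and for which there is no nonzero h ∈ M(P_{n−1,n}) such that g − h is again strictly monotone with all values positive, has exactly n − 1 elements. (Equivalently, the Cohen–Macaulay type of the monoid Q_p(U(n−1,n)) equals n − 1.) -/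
section helpers

variable {E : Type*} [Fintype E] [DecidableEq E]

/-- The edges of the digraph of `U(n-1,n)`. -/
lemma edge_iff (hn : 2 ≤ Fintype.card E) (rk : Finset E → ℕ)
    (hrk : ∀ A : Finset E, rk A = min A.card (Fintype.card E - 1)) (A B : Finset E) :
    MEdge rk A B ↔ (A ≠ Finset.univ ∧ B ≠ Finset.univ ∧ ∃ e ∉ A, B = insert e A) ∨
      (A = Finset.univ ∧ B.card + 1 = Fintype.card E) := by
  have hu : ∀ C : Finset E, C = Finset.univ ↔ C.card = Fintype.card E := fun C =>
    (Finset.card_eq_iff_eq_univ C).symm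
  have hle : ∀ C : Finset E, C.card ≤ Fintype.card E := fun C => Finset.card_le_univ C
  unfold MEdge
  simp only [hrk]
  constructor
  · rintro (⟨e, he, rfl, h⟩ | ⟨e, he, rfl, h⟩)
    · left
      rw [Finset.card_insert_of_notMem he] at h
      refine ⟨?_, ?_, e, he, rfl⟩
      · intro h1; rw [h1] at he; simp at he
      · intro h1; rw [hu, Finset.card_insert_of_notMem he] at h1; omega
    · right
      have h2 := hle (insert e B)
      rw [Finset.card_insert_of_notMem he] at h h2
      rw [hu, Finset.card_insert_of_notMem he]
      omega
  · rintro (⟨h1, h2, e, he, rfl⟩ | ⟨rfl, h⟩)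
    · left
      refine ⟨e, he, rfl, ?_⟩
      have h3 := hle (insert e A)
      rw [Ne, hu] at h2
      rw [Finset.card_insert_of_notMem he] at *
      omega
    · right
      have hB : ∃ e, e ∉ B := by
        by_contra hc
        push Not at hc
        have : B = Finset.univ := Finset.eq_univ_of_forall hc
        rw [hu] at this; omega
      obtain ⟨e, he⟩ := hB
      refine ⟨e, he, ?_, ?_⟩
      · symm; rw [hu, Finset.card_insert_of_notMem he, h]
      · rw [Finset.card_univ]; omega

lemma strict_of_edge {α : Type*} {r : α → α → Prop} {g : α → ℕ}
    (h : ∀ a b, r a b → g a < g b) :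
    ∀ a b, Relation.ReflTransGen r a b → a ≠ b → g a < g b := by
  have key : ∀ a b, Relation.ReflTransGen r a b → a = b ∨ g a < g b := by
    intro a b hab
    induction hab with
    | refl => exact Or.inl rfl
    | tail _ hbc ih =>
      right
      have := h _ _ hbc
      rcases ih with rfl | ih
      · exact this
      · omega
  intro a b hab hne
  exact (key a b hab).resolve_left hne

lemma mono_of_edge {α : Type*} {r : α → α → Prop} {g : α → ℕ}
    (h : ∀ a b, r a b → g a ≤ g b) :
    ∀ a b, Relation.ReflTransGen r a b → g a ≤ g b := by
  intro a b hab
  induction hab with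
  | refl => exact le_rfl
  | tail _ hbc ih => exact ih.trans (h _ _ hbc)

lemma lower_bound {g : Finset E → ℕ}
    (hg : ∀ A : Finset E, A ≠ Finset.univ → ∀ e ∉ A, insert e A ≠ Finset.univ →
      g A < g (insert e A)) (hpos : ∀ A, 0 < g A) (A : Finset E) :
    A ≠ Finset.univ → A.card + 1 ≤ g A := by
  induction A using Finset.induction_on with
  | empty => intro _; have := hpos ∅; simp; omega
  | insert e A he ih =>
    intro h
    have hA : A ≠ Finset.univ := by rintro rfl; simp at he
    have h1 := ih hA
    have h2 := hg A hA e he h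
    rw [Finset.card_insert_of_notMem he]
    omega

end helpers

theorem stmt18 {E : Type*} [Fintype E] [DecidableEq E]
    (hn : 2 ≤ Fintype.card E)
    (rk : Finset E → ℕ) (hrk : ∀ A : Finset E, rk A = min A.card (Fintype.card E - 1)) :
    {g : Finset E → ℕ |
      (∀ A B : Finset E, Relation.ReflTransGen (MEdge rk) A B → A ≠ B → g A < g B) ∧
      (∀ A : Finset E, 0 < g A) ∧
      ¬∃ h g' : Finset E → ℕ,
        (∀ A B : Finset E, Relation.ReflTransGen (MEdge rk) A B → h A ≤ h B) ∧ h ≠ 0 ∧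
        (∀ A B : Finset E, Relation.ReflTransGen (MEdge rk) A B → A ≠ B → g' A < g' B) ∧
        (∀ A : Finset E, 0 < g' A) ∧ g = g' + h}.ncard = Fintype.card E - 1 := by
  classical
  have hedge := edge_iff hn rk hrk
  have hcu : ∀ B : Finset E, B.card + 1 = Fintype.card E → B ≠ Finset.univ := by
    rintro B hB rfl
    rw [Finset.card_univ] at hB; omega
  -- strict monotonicity, unpacked along edges
  have hS1 : ∀ g : Finset E → ℕ,
      (∀ A B : Finset E, Relation.ReflTransGen (MEdge rk) A B → A ≠ B → g A < g B) →
      (∀ A : Finset E, A ≠ Finset.univ → ∀ e ∉ A, insert e A ≠ Finset.univ →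
        g A < g (insert e A)) ∧
      (∀ B : Finset E, B.card + 1 = Fintype.card E → g Finset.univ < g B) := by
    intro g hg
    constructor
    · intro A hA e he hB
      refine hg _ _ (Relation.ReflTransGen.single ((hedge _ _).2
        (Or.inl ⟨hA, hB, e, he, rfl⟩))) ?_
      intro h
      exact he (h ▸ Finset.mem_insert_self e A)
    · intro B hB
      exact hg _ _ (Relation.ReflTransGen.single ((hedge _ _).2 (Or.inr ⟨rfl, hB⟩)))
        (hcu B hB).symm
  have hS2 : ∀ g : Finset E → ℕ,
      (∀ A : Finset E, A ≠ Finset.univ → ∀ e ∉ A, insert e A ≠ Finset.univ →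
        g A < g (insert e A)) →
      (∀ B : Finset E, B.card + 1 = Fintype.card E → g Finset.univ < g B) →
      (∀ A B : Finset E, Relation.ReflTransGen (MEdge rk) A B → A ≠ B → g A < g B) := by
    intro g h1 h2
    apply strict_of_edge
    intro A B hAB
    rcases (hedge _ _).1 hAB with ⟨hA, hB, e, he, rfl⟩ | ⟨rfl, hB⟩
    · exact h1 A hA e he hB
    · exact h2 B hB
  obtain ⟨C, hC⟩ : ∃ C : Finset E, C.card + 1 = Fintype.card E := by
    have : Nonempty E := Fintype.card_pos_iff.1 (by omega)
    obtain ⟨e⟩ := this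
    refine ⟨Finset.univ.erase e, ?_⟩
    rw [Finset.card_erase_of_mem (Finset.mem_univ e), Finset.card_univ]; omega
  let F : ℕ → Finset E → ℕ := fun c A => if A = Finset.univ then c else A.card + 1
  have hFu : ∀ c, F c Finset.univ = c := fun c => by simp [F]
  have hFp : ∀ c A, A ≠ Finset.univ → F c A = A.card + 1 := fun c A hA => by simp [F, hA]
  have hF : Function.Injective F := by
    intro a b hab
    have := congrFun hab Finset.univ
    rwa [hFu, hFu] at this
  have hset : ∀ S : Set (Finset E → ℕ),
      S = F '' (↑(Finset.Icc 1 (Fintype.card E - 1)) : Set ℕ) →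
      S.ncard = Fintype.card E - 1 := by
    rintro S rfl
    rw [Set.ncard_image_of_injective _ hF, Set.ncard_coe_finset, Nat.card_Icc]
    omega
  apply hset
  ext g
  simp only [Set.mem_setOf_eq, Set.mem_image, Finset.mem_coe, Finset.mem_Icc]
  constructor
  · rintro ⟨hg, hpos, hmin⟩
    obtain ⟨hg1, hg2⟩ := hS1 g hg
    have hlow := lower_bound hg1 hpos
    let h : Finset E → ℕ := fun A =>
      if A = Finset.univ then (if Fintype.card E ≤ g A then 1 else 0)
      else (if A.card + 1 < g A then 1 else 0)
    have hu : h Finset.univ = if Fintype.card E ≤ g Finset.univ then 1 else 0 := by simp [h]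
    have hp : ∀ A, A ≠ Finset.univ → h A = if A.card + 1 < g A then 1 else 0 :=
      fun A hA => by simp [h, hA]
    have h0 : h = 0 := by
      by_contra hne
      refine hmin ⟨h, g - h, ?_, hne, ?_, ?_, ?_⟩
      · apply mono_of_edge
        intro A B hAB
        rcases (hedge _ _).1 hAB with ⟨hA, hB, e, he, rfl⟩ | ⟨rfl, hB⟩
        · have := hg1 A hA e he hB
          rw [hp _ hA, hp _ hB, Finset.card_insert_of_notMem he]
          split_ifs <;> omega
        · have := hg2 B hB
          rw [hu, hp _ (hcu B hB)]
          split_ifs <;> omega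
      · apply hS2
        · intro A hA e he hB
          have := hg1 A hA e he hB
          have := hlow A hA
          simp only [Pi.sub_apply]
          rw [hp _ hA, hp _ hB, Finset.card_insert_of_notMem he]
          split_ifs <;> omega
        · intro B hB
          have := hg2 B hB
          have := hlow B (hcu B hB)
          simp only [Pi.sub_apply]
          rw [hu, hp _ (hcu B hB)]
          split_ifs <;> omega
      · intro A
        have := hpos A
        simp only [Pi.sub_apply]
        by_cases hA : A = Finset.univ
        · subst hA
          rw [hu]; split_ifs <;> omega
        · rw [hp _ hA]; split_ifs <;> omega
      · funext A
        have := hpos A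
        simp only [Pi.sub_apply, Pi.add_apply]
        by_cases hA : A = Finset.univ
        · subst hA
          rw [hu]; split_ifs <;> omega
        · rw [hp _ hA]; split_ifs <;> omega
    refine ⟨g Finset.univ, ⟨hpos _, ?_⟩, ?_⟩
    · have := congrFun h0 Finset.univ
      rw [hu] at this
      simp at this
      omega
    · funext A
      by_cases hA : A = Finset.univ
      · subst hA; exact hFu _
      · rw [hFp _ _ hA]
        have h1 := congrFun h0 A
        have h2 := hlow A hA
        rw [hp _ hA] at h1
        simp at h1
        omega
  · rintro ⟨c, ⟨hc1, hc2⟩, rfl⟩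
    refine ⟨?_, ?_, ?_⟩
    · apply hS2
      · intro A hA e he hB
        rw [hFp _ _ hA, hFp _ _ hB, Finset.card_insert_of_notMem he]
        omega
      · intro B hB
        rw [hFu, hFp _ _ (hcu B hB)]
        omega
    · intro A
      by_cases hA : A = Finset.univ
      · subst hA; rw [hFu]; omega
      · rw [hFp _ _ hA]; omega
    · rintro ⟨h, g', hm, hne, hg', hpos, heq⟩
      obtain ⟨hg1, hg2⟩ := hS1 g' hg'
      have hlow := lower_bound hg1 hpos
      have hz : ∀ A, A ≠ Finset.univ → h A = 0 := by
        intro A hA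
        have h1 := congrFun heq A
        have h2 := hlow A hA
        rw [hFp _ _ hA, Pi.add_apply] at h1
        omega
      apply hne
      funext A
      by_cases hA : A = Finset.univ
      · subst hA
        have h1 := hm _ _ (Relation.ReflTransGen.single ((hedge _ _).2 (Or.inr ⟨rfl, hC⟩)))
        rw [hz C (hcu C hC)] at h1
        exact Nat.le_zero.1 h1
      · exact hz A hA
end
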